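/- Let A be a commutative ring and I ⊆ A a nilpotent ideal. Let M be an A-module such that M/IM is a flat A/I-module and Tor_1^A(A/I, M) = 0. Then M is a flat A-module. -/

import Mathlib

open TensorProduct

/-- Snake-type lemma. -/
theorem flatAux_snake {R : Type*} [CommRing R] {X Y N K F M : Type*}
    [AddCommGroup X] [AddCommGroup Y] [AddCommGroup N] [AddCommGroup K] [AddCommGroup F]
    [AddCommGroup M] [Module R X] [Module R Y] [Module R N] [Module R K] [Module R F]
    [Module R M] (i : X →ₗ[R] Y) (p : Y →ₗ[R] N) (hip : Function.Exact i p)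
    (hp : Function.Surjective p) (k : K →ₗ[R] F) (q : F →ₗ[R] M)
    (hkq : Function.Exact k q) (hq : Function.Surjective q)
    (hF : Function.Injective (i.rTensor F)) (hN : Function.Injective (k.lTensor N)) :
    Function.Injective (i.rTensor M) := by
  rw [injective_iff_map_eq_zero]
  intro z hz
  obtain ⟨w, rfl⟩ := LinearMap.lTensor_surjective X hq z
  have h1 : q.lTensor Y (i.rTensor F w) = 0 := by
    rw [← hz, ← LinearMap.comp_apply, ← LinearMap.comp_apply, LinearMap.lTensor_comp_rTensor,
      LinearMap.rTensor_comp_lTensor]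
  obtain ⟨u, hu⟩ := (lTensor_exact Y hkq hq _).1 h1
  have h2 : k.lTensor N (p.rTensor K u) = 0 := by
    have : k.lTensor N (p.rTensor K u) = p.rTensor F (k.lTensor Y u) := by
      rw [← LinearMap.comp_apply, ← LinearMap.comp_apply, LinearMap.lTensor_comp_rTensor,
        LinearMap.rTensor_comp_lTensor]
    rw [this, hu]
    exact (rTensor_exact F hip hp _).2 ⟨w, rfl⟩
  have h3 : p.rTensor K u = 0 := hN (by rw [h2, map_zero])
  obtain ⟨v, rfl⟩ := (rTensor_exact K hip hp _).1 h3
  have h4 : w = k.lTensor X v := by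
    apply hF
    rw [← hu, ← LinearMap.comp_apply, ← LinearMap.comp_apply, LinearMap.lTensor_comp_rTensor,
      LinearMap.rTensor_comp_lTensor]
  rw [h4]
  exact (lTensor_exact X hkq hq _).2 ⟨v, rfl⟩

/-- Extensions. -/
theorem flatAux_ext {R : Type*} [CommRing R] {X Y N K F : Type*}
    [AddCommGroup X] [AddCommGroup Y] [AddCommGroup N] [AddCommGroup K] [AddCommGroup F]
    [Module R X] [Module R Y] [Module R N] [Module R K] [Module R F]
    (i : X →ₗ[R] Y) (p : Y →ₗ[R] N) (hip : Function.Exact i p)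
    (hp : Function.Surjective p) (k : K →ₗ[R] F)
    (hF : Function.Injective (i.rTensor F)) (hN : Function.Injective (k.lTensor N))
    (hX : Function.Injective (k.lTensor X)) :
    Function.Injective (k.lTensor Y) := by
  rw [injective_iff_map_eq_zero]
  intro u hu
  have h2 : k.lTensor N (p.rTensor K u) = 0 := by
    have : k.lTensor N (p.rTensor K u) = p.rTensor F (k.lTensor Y u) := by
      rw [← LinearMap.comp_apply, ← LinearMap.comp_apply, LinearMap.lTensor_comp_rTensor,
        LinearMap.rTensor_comp_lTensor]
    rw [this, hu, map_zero]
  have h3 : p.rTensor K u = 0 := hN (by rw [h2, map_zero])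
  obtain ⟨v, rfl⟩ := (rTensor_exact K hip hp _).1 h3
  have h4 : k.lTensor X v = 0 := by
    apply hF
    rw [map_zero, ← hu, ← LinearMap.comp_apply, ← LinearMap.comp_apply,
      LinearMap.lTensor_comp_rTensor, LinearMap.rTensor_comp_lTensor]
  rw [hX (h4.trans (map_zero _).symm), map_zero]

/-- Modules over the quotient ring. -/
theorem flatAux_base {A B : Type*} [CommRing A] [CommRing B] [Algebra A B] {N K F M : Type*}
    [AddCommGroup N] [AddCommGroup K] [AddCommGroup F] [AddCommGroup M]
    [Module A N] [Module B N] [IsScalarTower A B N]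
    [Module A K] [Module A F] [Module A M]
    (k : K →ₗ[A] F) (q : F →ₗ[A] M)
    (hkq : Function.Exact k q) (hq : Function.Surjective q)
    (hM : Module.Flat B (B ⊗[A] M)) (hB : Function.Injective (k.lTensor B)) :
    Function.Injective (k.lTensor N) := by
  have h := LinearMap.lTensor_injective_of_exact_of_flat
    (q.baseChange B) (LinearMap.baseChange_surjective B hq) (k.baseChange B) hB
    (lTensor_exact B hkq hq) N
  have hc : ∀ x, k.lTensor N (AlgebraTensorModule.cancelBaseChange A B B N K x) =
      AlgebraTensorModule.cancelBaseChange A B B N F ((k.baseChange B).lTensor N x) := fun x =>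
    LinearMap.congr_fun (AlgebraTensorModule.lTensor_comp_cancelBaseChange A B B k) x
  intro x y hxy
  obtain ⟨x, rfl⟩ := (AlgebraTensorModule.cancelBaseChange A B B N K).surjective x
  obtain ⟨y, rfl⟩ := (AlgebraTensorModule.cancelBaseChange A B B N K).surjective y
  rw [hc, hc] at hxy
  rw [h ((AlgebraTensorModule.cancelBaseChange A B B N F).injective hxy)]

theorem flatAux_ind.{u, v, x, w} {A : Type u} [CommRing A] (I : Ideal A) {K : Type v} {F : Type x}
    [AddCommGroup K] [AddCommGroup F] [Module A K] [Module A F] [Module.Flat A F]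
    (k : K →ₗ[A] F)
    (h : ∀ (N : Type w) [AddCommGroup N] [Module A N], (I • ⊤ : Submodule A N) = ⊥ →
      Function.Injective (k.lTensor N)) (n : ℕ) :
    ∀ (N : Type w) [AddCommGroup N] [Module A N], (I ^ n • ⊤ : Submodule A N) = ⊥ →
      Function.Injective (k.lTensor N) := by
  induction n with
  | zero =>
    intro N _ _ hN
    apply h
    rw [pow_zero, Ideal.one_eq_top, Submodule.top_smul] at hN
    rw [hN, Submodule.smul_bot]
  | succ n ih =>
    intro N _ _ hN
    refine flatAux_ext (I • ⊤ : Submodule A N).subtype (I • ⊤ : Submodule A N).mkQ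
      (LinearMap.exact_subtype_mkQ _) (Submodule.mkQ_surjective _) k
      (Module.Flat.rTensor_preserves_injective_linearMap _ (Submodule.subtype_injective _))
      (h _ ?_) (ih _ ?_)
    · rw [← (Submodule.range_mkQ (I • ⊤ : Submodule A N)), LinearMap.range_eq_map,
        ← Submodule.map_smul'', Submodule.mkQ_map_self]
    · apply Submodule.map_injective_of_injective
        (Submodule.subtype_injective (I • ⊤ : Submodule A N))
      rw [Submodule.map_smul'', Submodule.map_bot, Submodule.map_subtype_top,
        ← Submodule.mul_smul, ← pow_succ, hN]

theorem flatAux_core {A : Type*} [CommRing A] {I : Ideal A} {n : ℕ} (hn : I ^ n = ⊥)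
    {M : Type*} [AddCommGroup M] [Module A M]
    (hflat : Module.Flat (A ⧸ I) (M ⧸ (I • ⊤ : Submodule A M)))
    (htor : Function.Injective (LinearMap.rTensor M I.subtype))
    {K F : Type*} [AddCommGroup K] [AddCommGroup F] [Module A K] [Module A F] [Module.Flat A F]
    (k : K →ₗ[A] F) (q : F →ₗ[A] M) (hk : Function.Injective k)
    (hkq : Function.Exact k q) (hq : Function.Surjective q) :
    Module.Flat A M := by
  have hM : Module.Flat (A ⧸ I) ((A ⧸ I) ⊗[A] M) :=
    Module.Flat.of_linearEquiv (LinearEquiv.extendScalarsOfSurjective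
      (S := A ⧸ I) Ideal.Quotient.mk_surjective (quotTensorEquivQuotSMul M I))
  have hB : Function.Injective (k.lTensor (A ⧸ I)) := by
    rw [LinearMap.lTensor_inj_iff_rTensor_inj]
    refine flatAux_snake k q hkq hq I.subtype I.mkQ (LinearMap.exact_subtype_mkQ _)
      (Submodule.mkQ_surjective _)
      (Module.Flat.rTensor_preserves_injective_linearMap _ hk) ?_
    rwa [LinearMap.lTensor_inj_iff_rTensor_inj]
  have key := flatAux_ind I k (fun N _ _ hN => by
    have ht : Module.IsTorsionBySet A N I := by
      intro x a
      have : (a : A) • x ∈ (I • ⊤ : Submodule A N) := Submodule.smul_mem_smul a.2 trivial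
      rwa [hN] at this
    let _ := ht.module
    exact flatAux_base (B := A ⧸ I) k q hkq hq hM hB) n
  rw [Module.Flat.iff_rTensor_injective']
  intro J
  exact flatAux_snake J.subtype J.mkQ (LinearMap.exact_subtype_mkQ _)
      (Submodule.mkQ_surjective _) k q hkq hq
      (Module.Flat.rTensor_preserves_injective_linearMap _ (Submodule.subtype_injective _))
      (key _ (by rw [hn, Submodule.bot_smul]))

/-- **Local criterion for flatness along a nilpotent ideal.** If `I` is nilpotent, `M/IM`
is flat over `A/I`, and `Tor₁^A(A/I, M) = 0` (expressed as injectivity of the natural map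
`I ⊗[A] M → A ⊗[A] M`, which is equivalent to the vanishing of `Tor₁^A(A/I, M)`), then
`M` is a flat `A`-module. -/
theorem flat_of_flat_mod_nilpotent_of_tor_vanishes
    {A : Type*} [CommRing A] {I : Ideal A} (hI : ∃ n : ℕ, n ≥ 1 ∧ I ^ n = ⊥)
    (M : Type*) [AddCommGroup M] [Module A M]
    (hflat : Module.Flat (A ⧸ I) (M ⧸ (I • ⊤ : Submodule A M)))
    (htor : Function.Injective (LinearMap.rTensor M I.subtype)) :
    Module.Flat A M := by
  obtain ⟨n, -, hn⟩ := hI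
  obtain ⟨q, hq⟩ : ∃ q : (M →₀ A) →ₗ[A] M, Function.Surjective q :=
    ⟨_, Finsupp.linearCombination_id_surjective A M⟩
  exact flatAux_core (K := LinearMap.ker q) (F := M →₀ A) hn hflat htor
    (LinearMap.ker q).subtype q (Submodule.subtype_injective _)
    (LinearMap.exact_subtype_ker_map q) hq
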